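/- arXiv:1005.2880 — 13 statements merged into one kernel-verified Lean document; each statement's English description precedes it below -/
import Mathlib

section
/- For every real p > 1, every measurable function ζ : X → [0,∞) such that ζ is μ-integrable, the function x ↦ ζ(x)^{p/(p−1)} · ∑_{i=1}^M p_i(x)^{1/(1−p)} is μ-integrable, and ∫_X ζ(x)^{p/(p−1)} ∑_{i=1}^M p_i(x)^{1/(1−p)} dμ(x) > 0, and every detector d, the probability of error satisfies P_e(d) ≥ (M−1)^p · (∫_X ζ(x) dμ(x))^p · (∫_X ζ(x)^{p/(p−1)} ∑_{i=1}^M p_i(x)^{1/(1−p)} dμ(x))^{1−p}. -/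
open MeasureTheory Real Filter Topology

/-- Hölder's inequality for a finite sum of products of mutually inverse powers. -/
lemma card_mul_le_sum_rpow_mul_sum_rpow {ι : Type*} (s : Finset ι) {q r : ℝ}
    (hqr : q.HolderConjugate r) {a : ι → ℝ} (ha : ∀ i, 0 < a i) {z : ℝ} (hz : 0 ≤ z) :
    (s.card : ℝ) * z
      ≤ (∑ i ∈ s, a i) ^ (1 / q) * (z ^ r * ∑ i ∈ s, a i ^ (1 / (1 - q))) ^ (1 / r) := by
  have h := Real.inner_le_Lp_mul_Lq_of_nonneg s (f := fun i => a i ^ (1 / q))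
    (g := fun i => z * a i ^ (-(1 / q))) hqr
    (fun i _ => (rpow_pos_of_pos (ha i) _).le)
    (fun i _ => mul_nonneg hz (rpow_pos_of_pos (ha i) _).le)
  have h_prod : ∀ i, a i ^ (1 / q) * (z * a i ^ (-(1 / q))) = z := fun i => by
    rw [mul_left_comm, ← rpow_add (ha i), add_neg_cancel, rpow_zero, mul_one]
  have h_left : ∀ i, (a i ^ (1 / q)) ^ q = a i := fun i => by
    rw [← rpow_mul (ha i).le, one_div_mul_cancel hqr.ne_zero, rpow_one]
  have h_exp : -(1 / q) * r = 1 / (1 - q) := by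
    have h1 : 1 - q ≠ 0 := by linarith [hqr.sub_one_pos]
    have h2 := hqr.sub_one_ne_zero
    have h3 := hqr.ne_zero
    rw [hqr.conjugate_eq]
    grind
  have h_right : ∀ i, (z * a i ^ (-(1 / q))) ^ r = z ^ r * a i ^ (1 / (1 - q)) := fun i => by
    rw [mul_rpow hz (rpow_pos_of_pos (ha i) _).le, ← rpow_mul (ha i).le, h_exp]
  simpa only [h_prod, h_left, h_right, Finset.sum_const, nsmul_eq_mul, ← Finset.mul_sum] using h

lemma memLp_rpow_one_div {X : Type*} [MeasurableSpace X] {μ : Measure X} {f : X → ℝ}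
    (hf : Integrable f μ) (hf0 : ∀ x, 0 ≤ f x) {q : ℝ} (hq : 0 < q) :
    MemLp (fun x => f x ^ (1 / q)) (ENNReal.ofReal q) μ := by
  have hm : AEStronglyMeasurable (fun x => f x ^ (1 / q)) μ :=
    (hf.aemeasurable.pow_const _).aestronglyMeasurable
  rw [← integrable_norm_rpow_iff hm (by simpa using hq) ENNReal.ofReal_ne_top,
    ENNReal.toReal_ofReal hq.le]
  refine hf.congr (Eventually.of_forall fun x => ?_)
  simp only [norm_of_nonneg (rpow_nonneg (hf0 x) _)]
  rw [← rpow_mul (hf0 x), one_div_mul_cancel hq.ne', rpow_one]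

/-- If `h ≤ f ^ (1 / q) * g ^ (1 / r)` pointwise, then the same bound holds for the integrals. -/
lemma integral_le_integral_rpow_mul_integral_rpow {X : Type*} [MeasurableSpace X] {μ : Measure X}
    {q r : ℝ} (hqr : q.HolderConjugate r) {f g h : X → ℝ}
    (hf : Integrable f μ) (hg : Integrable g μ) (hh : Integrable h μ)
    (hf0 : ∀ x, 0 ≤ f x) (hg0 : ∀ x, 0 ≤ g x)
    (hle : ∀ x, h x ≤ f x ^ (1 / q) * g x ^ (1 / r)) :
    ∫ x, h x ∂μ ≤ (∫ x, f x ∂μ) ^ (1 / q) * (∫ x, g x ∂μ) ^ (1 / r) := by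
  have hF := memLp_rpow_one_div hf hf0 hqr.pos
  have hG := memLp_rpow_one_div hg hg0 hqr.symm.pos
  have : (ENNReal.ofReal q).HolderConjugate (ENNReal.ofReal r) := hqr.ennrealOfReal
  have hf_pow : ∀ x, (f x ^ (1 / q)) ^ q = f x := fun x => by
    rw [← rpow_mul (hf0 x), one_div_mul_cancel hqr.ne_zero, rpow_one]
  have hg_pow : ∀ x, (g x ^ (1 / r)) ^ r = g x := fun x => by
    rw [← rpow_mul (hg0 x), one_div_mul_cancel hqr.symm.ne_zero, rpow_one]
  have holder := integral_mul_le_Lp_mul_Lq_of_nonneg hqr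
    (Eventually.of_forall fun x => rpow_nonneg (hf0 x) _)
    (Eventually.of_forall fun x => rpow_nonneg (hg0 x) _) hF hG
  simp only [hf_pow, hg_pow] at holder
  exact (integral_mono hh (hF.integrable_mul hG) hle).trans holder

/-- first class of lower bounds on the probability of error,
for an arbitrary nonnegative integrable `ζ`. -/
theorem first_class_lower_bound
    {X : Type*} [MeasurableSpace X] (μ : Measure X) [IsProbabilityMeasure μ]
    {M : ℕ} (hM : 2 ≤ M) (p : Fin M → X → ℝ)
    (hpmeas : ∀ i, Measurable (p i))
    (hppos : ∀ i x, 0 < p i x)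
    (hpsum : ∀ᵐ x ∂μ, ∑ i, p i x = 1)
    (q : ℝ) (hq : 1 < q)
    (ζ : X → ℝ) (hζmeas : Measurable ζ) (hζnonneg : ∀ x, 0 ≤ ζ x)
    (hζint : Integrable ζ μ)
    (hint : Integrable (fun x => ζ x ^ (q / (q - 1)) * ∑ i, p i x ^ (1 / (1 - q))) μ)
    (hintpos : 0 < ∫ x, ζ x ^ (q / (q - 1)) * ∑ i, p i x ^ (1 / (1 - q)) ∂μ)
    (d : X → Fin M) (hd : Measurable d) :
    ((M : ℝ) - 1) ^ q * (∫ x, ζ x ∂μ) ^ q *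
        (∫ x, ζ x ^ (q / (q - 1)) * ∑ i, p i x ^ (1 / (1 - q)) ∂μ) ^ (1 - q)
      ≤ ∫ x, (1 - p (d x) x) ∂μ := by
  have hqr : q.HolderConjugate (q / (q - 1)) := HolderConjugate.conjExponent hq
  set B := ∫ x, ζ x ^ (q / (q - 1)) * ∑ i, p i x ^ (1 / (1 - q)) ∂μ
  have hM1 : (0 : ℝ) ≤ M - 1 := by
    have : (2 : ℝ) ≤ M := by exact_mod_cast hM
    linarith
  have h_error : ∀ᵐ x ∂μ, 1 - p (d x) x = ∑ i ∈ Finset.univ.erase (d x), p i x := by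
    filter_upwards [hpsum] with x hx
    rw [← hx, ← Finset.add_sum_erase _ _ (Finset.mem_univ (d x)), add_sub_cancel_left]
  have h_error_nonneg : ∀ x, 0 ≤ ∑ i ∈ Finset.univ.erase (d x), p i x :=
    fun x => Finset.sum_nonneg fun i _ => (hppos i x).le
  have h_error_meas : Measurable fun x => 1 - p (d x) x :=
    ((measurable_from_prod_countable_left (f := fun y : X × Fin M => p y.2 y.1) hpmeas).comp
      (measurable_id.prodMk hd)).const_sub 1
  have h_error_int : Integrable (fun x => 1 - p (d x) x) μ := by
    refine Integrable.of_bound h_error_meas.aestronglyMeasurable 1 ?_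
    filter_upwards [h_error] with x hx
    rw [norm_of_nonneg (hx ▸ h_error_nonneg x)]
    linarith [hppos (d x) x]
  have h_int := integral_le_integral_rpow_mul_integral_rpow hqr
    (h_error_int.congr h_error) hint (hζint.const_mul ((M : ℝ) - 1)) h_error_nonneg
    (fun x => mul_nonneg (rpow_nonneg (hζnonneg x) _)
      (Finset.sum_nonneg fun i _ => (rpow_pos_of_pos (hppos i x) _).le))
    (fun x => by
      have h := card_mul_le_sum_rpow_mul_sum_rpow (Finset.univ.erase (d x)) hqr
        (a := fun i => p i x) (fun i => hppos i x) (hζnonneg x)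
      rw [Finset.card_erase_of_mem (Finset.mem_univ _), Finset.card_univ, Fintype.card_fin,
        Nat.cast_sub (by omega), Nat.cast_one] at h
      refine h.trans ?_
      have hsub : ∑ i ∈ Finset.univ.erase (d x), p i x ^ (1 / (1 - q))
          ≤ ∑ i, p i x ^ (1 / (1 - q)) :=
        Finset.sum_le_sum_of_subset_of_nonneg (Finset.erase_subset _ _)
          fun i _ _ => (rpow_pos_of_pos (hppos i x) _).le
      have hz := rpow_nonneg (hζnonneg x) (q / (q - 1))
      refine mul_le_mul_of_nonneg_left (rpow_le_rpow (mul_nonneg hz ?_)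
        (mul_le_mul_of_nonneg_left hsub hz) hqr.symm.one_div_nonneg)
        (rpow_nonneg (h_error_nonneg x) _)
      exact Finset.sum_nonneg fun i _ => (rpow_pos_of_pos (hppos i x) _).le)
  rw [← integral_congr_ae h_error, integral_const_mul] at h_int
  have h_Pe : 0 ≤ ∫ x, (1 - p (d x) x) ∂μ := by
    rw [integral_congr_ae h_error]
    exact integral_nonneg h_error_nonneg
  have h_zeta : 0 ≤ ∫ x, ζ x ∂μ := integral_nonneg hζnonneg
  have h_pow := rpow_le_rpow (mul_nonneg hM1 h_zeta) h_int hqr.nonneg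
  rw [mul_rpow hM1 h_zeta, mul_rpow (rpow_nonneg h_Pe _) (rpow_nonneg hintpos.le _),
    ← rpow_mul h_Pe, ← rpow_mul hintpos.le, one_div_mul_cancel hqr.ne_zero, rpow_one,
    one_div_mul_eq_div, hqr.div_conj_eq_sub_one] at h_pow
  calc _ ≤ (∫ x, (1 - p (d x) x) ∂μ) * B ^ (q - 1) * B ^ (1 - q) :=
        mul_le_mul_of_nonneg_right h_pow (rpow_nonneg hintpos.le _)
    _ = ∫ x, (1 - p (d x) x) ∂μ := by
        rw [mul_assoc, ← rpow_add hintpos, sub_add_sub_cancel, sub_self, rpow_zero, mul_one]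
end

section
/- For every real p > 1, every measurable function ζ : X → (0,∞) such that ζ is μ-integrable and the function x ↦ ζ(x)^{1/(1−p)} · ∑_{i=1}^M p_i(x)^{p/(p−1)} is μ-integrable, and every detector d, the probability of error satisfies P_e(d) ≥ 1 − (∫_X ζ(x) dμ(x))^{1/p} · (∫_X ζ(x)^{1/(1−p)} ∑_{i=1}^M p_i(x)^{p/(p−1)} dμ(x))^{(p−1)/p}. -/
open MeasureTheory Real Filter Topology

/-- A nonnegative measurable function whose `r`-th power is integrable lies in `L^r`. -/
theorem memLp_of_integrable_rpow_of_nonneg {X : Type*} [MeasurableSpace X] {μ : Measure X}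
    {f : X → ℝ} {r : ℝ} (hr : 0 < r) (hf : Measurable f) (hf0 : ∀ x, 0 ≤ f x)
    (h : Integrable (fun x => f x ^ r) μ) : MemLp f (ENNReal.ofReal r) μ := by
  rw [← integrable_norm_rpow_iff hf.aestronglyMeasurable (by simpa using hr)
    ENNReal.ofReal_ne_top, ENNReal.toReal_ofReal hr.le]
  simpa only [Real.norm_of_nonneg (hf0 _)] using h

/-- Evaluating a countable measurable family at a measurable index is measurable. -/
theorem measurable_comp_index {X ι β : Type*} [MeasurableSpace X] [MeasurableSpace ι]
    [MeasurableSpace β] [Countable ι] [MeasurableSingletonClass ι] {p : ι → X → β}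
    (hp : ∀ i, Measurable (p i)) {d : X → ι} (hd : Measurable d) :
    Measurable fun x => p (d x) x :=
  (measurable_from_prod_countable_right (f := fun z : ι × X => p z.1 z.2) hp).comp
    (hd.prodMk measurable_id)

/-- second class of lower bounds on the probability of error,
for an arbitrary positive integrable `ζ`. -/
theorem second_class_lower_bound
    {X : Type*} [MeasurableSpace X] (μ : Measure X) [IsProbabilityMeasure μ]
    {M : ℕ} (hM : 2 ≤ M) (p : Fin M → X → ℝ)
    (hpmeas : ∀ i, Measurable (p i))
    (hppos : ∀ i x, 0 < p i x)
    (hpsum : ∀ᵐ x ∂μ, ∑ i, p i x = 1)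
    (q : ℝ) (hq : 1 < q)
    (ζ : X → ℝ) (hζmeas : Measurable ζ) (hζpos : ∀ x, 0 < ζ x)
    (hζint : Integrable ζ μ)
    (hint : Integrable (fun x => ζ x ^ (1 / (1 - q)) * ∑ i, p i x ^ (q / (q - 1))) μ)
    (d : X → Fin M) (hd : Measurable d) :
    1 - (∫ x, ζ x ∂μ) ^ (1 / q) *
        (∫ x, ζ x ^ (1 / (1 - q)) * ∑ i, p i x ^ (q / (q - 1)) ∂μ) ^ ((q - 1) / q)
      ≤ ∫ x, (1 - p (d x) x) ∂μ := by
  have hq0 : 0 < q := by linarith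
  have hq1 : 0 < q - 1 := by linarith
  set r := q / (q - 1) with hr
  have hr0 : 0 < r := div_pos hq0 hq1
  have hqr : q.HolderConjugate r := Real.HolderConjugate.conjExponent hq
  have hexp : (q - 1) / q = 1 / r := by rw [hr, one_div_div]
  have hpd : Measurable fun x => p (d x) x := measurable_comp_index hpmeas hd
  have hpd_int : Integrable (fun x => p (d x) x) μ := by
    refine Integrable.of_bound hpd.aestronglyMeasurable 1 ?_
    filter_upwards [hpsum] with x hx
    rw [Real.norm_of_nonneg (hppos _ x).le, ← hx]
    exact Finset.single_le_sum (f := fun i => p i x) (fun i _ => (hppos i x).le)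
      (Finset.mem_univ (d x))
  set f : X → ℝ := fun x => ζ x ^ (1 / q) with hf
  set g : X → ℝ := fun x => ζ x ^ (-(1 / q)) * p (d x) x with hg
  have hf0 : ∀ x, 0 ≤ f x := fun x => rpow_nonneg (hζpos x).le _
  have hg0 : ∀ x, 0 ≤ g x := fun x => mul_nonneg (rpow_nonneg (hζpos x).le _) (hppos _ x).le
  have hfm : Measurable f := hζmeas.pow_const _
  have hgm : Measurable g := (hζmeas.pow_const _).mul hpd
  have hfq : ∀ x, f x ^ q = ζ x := fun x => by
    rw [hf, ← rpow_mul (hζpos x).le, one_div_mul_cancel hq0.ne', rpow_one]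
  have hfg : ∀ x, f x * g x = p (d x) x := fun x => by
    simp only [hf, hg]
    rw [← mul_assoc, ← rpow_add (hζpos x), add_neg_cancel, rpow_zero, one_mul]
  have hgr : ∀ x, g x ^ r = ζ x ^ (1 / (1 - q)) * p (d x) x ^ r := fun x => by
    have hmul : -(1 / q) * r = 1 / (1 - q) := by
      have : 1 - q ≠ 0 := by linarith
      rw [hr]
      field_simp
      ring
    simp only [hg]
    rw [mul_rpow (rpow_nonneg (hζpos x).le _) (hppos _ x).le, ← rpow_mul (hζpos x).le, hmul]
  have hgle : ∀ x, g x ^ r ≤ ζ x ^ (1 / (1 - q)) * ∑ i, p i x ^ r := fun x => by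
    rw [hgr]
    exact mul_le_mul_of_nonneg_left
      (Finset.single_le_sum (f := fun i => p i x ^ r)
        (fun i _ => rpow_nonneg (hppos i x).le _) (Finset.mem_univ (d x)))
      (rpow_nonneg (hζpos x).le _)
  have hgr_int : Integrable (fun x => g x ^ r) μ := by
    refine hint.mono' (hgm.pow_const _).aestronglyMeasurable (Eventually.of_forall fun x => ?_)
    rw [Real.norm_of_nonneg (rpow_nonneg (hg0 x) _)]
    exact hgle x
  have holder := integral_mul_le_Lp_mul_Lq_of_nonneg (μ := μ) hqr
    (Eventually.of_forall hf0) (Eventually.of_forall hg0)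
    (memLp_of_integrable_rpow_of_nonneg hq0 hfm hf0 (by simpa only [hfq] using hζint))
    (memLp_of_integrable_rpow_of_nonneg hr0 hgm hg0 hgr_int)
  simp only [hfg, hfq] at holder
  have hmono : (∫ x, g x ^ r ∂μ) ^ (1 / r)
      ≤ (∫ x, ζ x ^ (1 / (1 - q)) * ∑ i, p i x ^ r ∂μ) ^ (1 / r) :=
    rpow_le_rpow (integral_nonneg fun x => rpow_nonneg (hg0 x) _)
      (integral_mono hgr_int hint hgle) (one_div_pos.2 hr0).le
  rw [integral_sub (integrable_const 1) hpd_int, integral_const, probReal_univ, one_smul, hexp]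
  exact sub_le_sub_left (holder.trans (mul_le_mul_of_nonneg_left hmono
    (rpow_nonneg (integral_nonneg fun x => (hζpos x).le) _))) 1
end

section
/- For every real p > 1 and every detector d, the probability of error satisfies P_e(d) ≥ B_p^{(1)} = (M−1)^p · ∫_X (∑_{i=1}^M p_i(x)^{1/(1−p)})^{1−p} dμ(x). -/
open MeasureTheory Real Filter Topology

/-- Hölder's inequality applied to `1 = a ^ (1 / q) * a ^ (-(1 / q))`. -/
theorem card_rpow_le_sum_mul_sum_rpow {ι : Type*} (s : Finset ι) (a : ι → ℝ)
    (ha : ∀ i ∈ s, 0 < a i) {q : ℝ} (hq : 1 < q) :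
    (s.card : ℝ) ^ q ≤ (∑ i ∈ s, a i) * (∑ i ∈ s, a i ^ (1 / (1 - q))) ^ (q - 1) := by
  have hq0 : q ≠ 0 := by linarith
  have hq1 : q - 1 ≠ 0 := by linarith
  have hq1' : 1 - q ≠ 0 := by linarith
  have hA : 0 ≤ ∑ i ∈ s, a i := Finset.sum_nonneg fun i hi => (ha i hi).le
  have hB : 0 ≤ ∑ i ∈ s, a i ^ (1 / (1 - q)) :=
    Finset.sum_nonneg fun i hi => rpow_nonneg (ha i hi).le _
  have holder := inner_le_Lp_mul_Lq_of_nonneg s (HolderConjugate.conjExponent hq)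
    (f := fun i => a i ^ (1 / q)) (g := fun i => a i ^ (-(1 / q)))
    (fun i hi => rpow_nonneg (ha i hi).le _) (fun i hi => rpow_nonneg (ha i hi).le _)
  have h1 : ∑ i ∈ s, a i ^ (1 / q) * a i ^ (-(1 / q)) = s.card := by
    rw [Finset.card_eq_sum_ones, Nat.cast_sum]
    refine Finset.sum_congr rfl fun i hi => ?_
    rw [← rpow_add (ha i hi)]
    simp
  have h2 : ∑ i ∈ s, (a i ^ (1 / q)) ^ q = ∑ i ∈ s, a i := by
    refine Finset.sum_congr rfl fun i hi => ?_
    rw [← rpow_mul (ha i hi).le, one_div_mul_cancel hq0, rpow_one]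
  have h3 : ∑ i ∈ s, (a i ^ (-(1 / q))) ^ conjExponent q = ∑ i ∈ s, a i ^ (1 / (1 - q)) := by
    refine Finset.sum_congr rfl fun i hi => ?_
    rw [← rpow_mul (ha i hi).le]
    congr 1
    rw [conjExponent, ← neg_sub q 1]
    field_simp
  rw [h1, h2, h3] at holder
  have key := rpow_le_rpow (Nat.cast_nonneg _) holder (by linarith : 0 ≤ q)
  rwa [mul_rpow (rpow_nonneg hA _) (rpow_nonneg hB _), ← rpow_mul hA, ← rpow_mul hB,
    one_div_mul_cancel hq0, rpow_one,
    show 1 / conjExponent q * q = q - 1 by rw [conjExponent]; field_simp] at key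

/-- The pointwise form of the bound on the probability of error. -/
theorem sub_one_rpow_mul_sum_rpow_le_one_sub {M : ℕ} (hM : 2 ≤ M) (a : Fin M → ℝ)
    (ha : ∀ i, 0 < a i) (hsum : ∑ i, a i = 1) {q : ℝ} (hq : 1 < q) (j : Fin M) :
    ((M : ℝ) - 1) ^ q * (∑ i, a i ^ (1 / (1 - q))) ^ (1 - q) ≤ 1 - a j := by
  have hcard : (((Finset.univ.erase j).card : ℕ) : ℝ) = (M : ℝ) - 1 := by
    rw [Finset.card_erase_of_mem (Finset.mem_univ j), Finset.card_fin,
      Nat.cast_sub (by omega), Nat.cast_one]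
  have herase : ∑ i ∈ Finset.univ.erase j, a i = 1 - a j := by
    rw [← hsum, ← Finset.add_sum_erase _ a (Finset.mem_univ j)]
    ring
  have holder := card_rpow_le_sum_mul_sum_rpow (Finset.univ.erase j) a (fun i _ => ha i) hq
  rw [hcard, herase] at holder
  have hj : 0 ≤ 1 - a j := herase ▸ Finset.sum_nonneg fun i _ => (ha i).le
  have hS : 0 < ∑ i, a i ^ (1 / (1 - q)) :=
    Finset.sum_pos (fun i _ => rpow_pos_of_pos (ha i) _) ⟨j, Finset.mem_univ j⟩
  have hmono : (∑ i ∈ Finset.univ.erase j, a i ^ (1 / (1 - q))) ^ (q - 1) ≤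
      (∑ i, a i ^ (1 / (1 - q))) ^ (q - 1) := by
    refine rpow_le_rpow (Finset.sum_nonneg fun i _ => rpow_nonneg (ha i).le _) ?_ (by linarith)
    exact Finset.sum_le_sum_of_subset_of_nonneg (Finset.erase_subset _ _)
      fun i _ _ => rpow_nonneg (ha i).le _
  have hinv : (∑ i, a i ^ (1 / (1 - q))) ^ (1 - q) =
      ((∑ i, a i ^ (1 / (1 - q))) ^ (q - 1))⁻¹ := by
    rw [← rpow_neg hS.le, neg_sub]
  rw [hinv, ← div_eq_mul_inv, div_le_iff₀ (rpow_pos_of_pos hS _)]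
  exact holder.trans (mul_le_mul_of_nonneg_left hmono hj)

/-- the tightest bound `B_p^{(1)}` of the first class is a lower bound
on the probability of error of every detector. -/
theorem B1_lower_bound
    {X : Type*} [MeasurableSpace X] (μ : Measure X) [IsProbabilityMeasure μ]
    {M : ℕ} (hM : 2 ≤ M) (p : Fin M → X → ℝ)
    (hpmeas : ∀ i, Measurable (p i))
    (hppos : ∀ i x, 0 < p i x)
    (hpsum : ∀ᵐ x ∂μ, ∑ i, p i x = 1)
    (q : ℝ) (hq : 1 < q)
    (d : X → Fin M) (hd : Measurable d) :
    ((M : ℝ) - 1) ^ q * ∫ x, (∑ i, p i x ^ (1 / (1 - q))) ^ (1 - q) ∂μ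
      ≤ ∫ x, (1 - p (d x) x) ∂μ := by
  have hM1 : (0 : ℝ) ≤ (M : ℝ) - 1 := by
    have : (2 : ℝ) ≤ M := by exact_mod_cast hM
    linarith
  have hmeas : Measurable fun x => p (d x) x :=
    (measurable_from_prod_countable_right (f := fun z : Fin M × X => p z.1 z.2) hpmeas).comp
      (hd.prodMk measurable_id)
  have hint : Integrable (fun x => 1 - p (d x) x) μ := by
    refine (integrable_const (1 : ℝ)).mono' (hmeas.const_sub 1).aestronglyMeasurable ?_
    filter_upwards [hpsum] with x hx
    have hle : p (d x) x ≤ 1 :=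
      hx ▸ Finset.single_le_sum (f := fun i => p i x) (fun i _ => (hppos i x).le)
        (Finset.mem_univ (d x))
    rw [Real.norm_eq_abs, abs_of_nonneg (by linarith)]
    linarith [hppos (d x) x]
  rw [← integral_const_mul]
  refine integral_mono_of_nonneg (.of_forall fun x => ?_) hint ?_
  · exact mul_nonneg (rpow_nonneg hM1 _)
      (rpow_nonneg (Finset.sum_nonneg fun i _ => rpow_nonneg (hppos i x).le _) _)
  · filter_upwards [hpsum] with x hx
    exact sub_one_rpow_mul_sum_rpow_le_one_sub hM (fun i => p i x) (fun i => hppos i x) hx hq (d x)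
end

section
/- For every real p > 1 and every detector d, the probability of error satisfies P_e(d) ≥ B_p^{(2)} = 1 − ∫_X (∑_{i=1}^M p_i(x)^{p/(p−1)})^{(p−1)/p} dμ(x). -/
open MeasureTheory Real Filter Topology

/-- Each term of a nonnegative finite family is at most the `ℓ^r` norm of the family. -/
theorem le_sum_rpow_rpow_inv {ι : Type*} [Fintype ι] {a : ι → ℝ} (ha : ∀ i, 0 ≤ a i)
    {r : ℝ} (hr : 0 < r) (j : ι) : a j ≤ (∑ i, a i ^ r) ^ r⁻¹ := by
  have h : a j ^ r ≤ ∑ i, a i ^ r :=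
    Finset.single_le_sum (fun i _ => rpow_nonneg (ha i) r) (Finset.mem_univ j)
  calc a j = (a j ^ r) ^ r⁻¹ := (rpow_rpow_inv (ha j) hr.ne').symm
    _ ≤ _ := rpow_le_rpow (rpow_nonneg (ha j) r) h (inv_nonneg.2 hr.le)

/-- The `ℓ^r` norm of a probability vector is at most `1` when `1 ≤ r`. -/
theorem sum_rpow_rpow_inv_le_one {ι : Type*} [Fintype ι] {a : ι → ℝ} (ha : ∀ i, 0 ≤ a i)
    (hsum : ∑ i, a i = 1) {r : ℝ} (hr : 1 ≤ r) : (∑ i, a i ^ r) ^ r⁻¹ ≤ 1 := by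
  refine rpow_le_one (Finset.sum_nonneg fun i _ => rpow_nonneg (ha i) r) ?_
    (inv_nonneg.2 (by linarith))
  rw [← hsum]
  refine Finset.sum_le_sum fun i _ => ?_
  have h1 : a i ≤ 1 := hsum ▸ Finset.single_le_sum (fun i _ => ha i) (Finset.mem_univ i)
  exact rpow_le_self_of_le_one (ha i) h1 hr

/-- Selecting among finitely many measurable functions by a measurable index is measurable. -/
theorem measurable_apply_index {X ι : Type*} [MeasurableSpace X] [Countable ι]
    [MeasurableSpace ι] [MeasurableSingletonClass ι] {p : ι → X → ℝ}
    (hp : ∀ i, Measurable (p i)) {d : X → ι} (hd : Measurable d) :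
    Measurable fun x => p (d x) x :=
  (measurable_from_prod_countable_right (f := fun z : ι × X => p z.1 z.2) hp).comp
    (hd.prodMk measurable_id)

/-- the tightest bound `B_p^{(2)}` of the second class is a lower bound
on the probability of error of every detector. -/
theorem B2_lower_bound
    {X : Type*} [MeasurableSpace X] (μ : Measure X) [IsProbabilityMeasure μ]
    {M : ℕ} (hM : 2 ≤ M) (p : Fin M → X → ℝ)
    (hpmeas : ∀ i, Measurable (p i))
    (hppos : ∀ i x, 0 < p i x)
    (hpsum : ∀ᵐ x ∂μ, ∑ i, p i x = 1)
    (q : ℝ) (hq : 1 < q)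
    (d : X → Fin M) (hd : Measurable d) :
    1 - ∫ x, (∑ i, p i x ^ (q / (q - 1))) ^ ((q - 1) / q) ∂μ
      ≤ ∫ x, (1 - p (d x) x) ∂μ := by
  have hr : 1 ≤ q / (q - 1) := by
    rw [le_div_iff₀ (by linarith)]
    linarith
  rw [← inv_div q (q - 1)]
  generalize q / (q - 1) = r at hr
  have hle (x : X) : p (d x) x ≤ (∑ i, p i x ^ r) ^ r⁻¹ :=
    le_sum_rpow_rpow_inv (a := fun i => p i x) (fun i => (hppos i x).le) (by linarith) (d x)
  have hg : Integrable (fun x => (∑ i, p i x ^ r) ^ r⁻¹) μ := by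
    refine Integrable.of_bound (C := 1) (Measurable.aestronglyMeasurable (by fun_prop)) ?_
    filter_upwards [hpsum] with x hx
    rw [norm_of_nonneg ((hppos (d x) x).le.trans (hle x))]
    exact sum_rpow_rpow_inv_le_one (fun i => (hppos i x).le) hx hr
  have hpd : Integrable (fun x => p (d x) x) μ := by
    refine hg.mono' (measurable_apply_index hpmeas hd).aestronglyMeasurable
      (Eventually.of_forall fun x => ?_)
    rw [norm_of_nonneg (hppos (d x) x).le]
    exact hle x
  rw [integral_sub (integrable_const 1) hpd, integral_const, probReal_univ, one_smul]
  exact sub_le_sub_left (integral_mono hpd hg hle) 1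
end

section
/- For every real p > 1 and every measurable ζ : X → [0,∞) such that ζ is μ-integrable, the function x ↦ ζ(x)^{p/(p−1)} S(x) is μ-integrable with ∫_X ζ^{p/(p−1)} S dμ > 0, where S(x) = ∑_{i=1}^M p_i(x)^{1/(1−p)}, one has (∫_X ζ dμ)^p · (∫_X ζ^{p/(p−1)} S dμ)^{1−p} ≤ ∫_X S(x)^{1−p} dμ(x); moreover equality holds for the choice ζ(x) = S(x)^{1−p}. Consequently B_p^{(1)} is the tightest bound in the first class. -/
open MeasureTheory Real Filter Topology

theorem memLp_ofReal_of_integrable_rpow {X : Type*} [MeasurableSpace X] {μ : Measure X}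
    {f : X → ℝ} {r : ℝ} (hr : 0 < r) (hf : Measurable f) (hf0 : ∀ x, 0 ≤ f x)
    (hint : Integrable (fun x => f x ^ r) μ) : MemLp f (ENNReal.ofReal r) μ := by
  rw [← integrable_norm_rpow_iff hf.aestronglyMeasurable (by simpa using hr)
    ENNReal.ofReal_ne_top, ENNReal.toReal_ofReal hr.le]
  simpa only [Real.norm_of_nonneg (hf0 _)] using hint

/-- Weighted Hölder inequality: `(∫ ζ)^q (∫ ζ^{q/(q-1)} S)^{1-q} ≤ ∫ S^{1-q}`. -/
theorem integral_rpow_mul_weighted_rpow_le {X : Type*} [MeasurableSpace X] {μ : Measure X}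
    {q : ℝ} (hq : 1 < q) {S ζ : X → ℝ} (hS : Measurable S) (hS0 : ∀ x, 0 < S x)
    (hSint : Integrable (fun x => S x ^ (1 - q)) μ)
    (hζ : Measurable ζ) (hζ0 : ∀ x, 0 ≤ ζ x)
    (hint : Integrable (fun x => ζ x ^ (q / (q - 1)) * S x) μ)
    (hpos : 0 < ∫ x, ζ x ^ (q / (q - 1)) * S x ∂μ) :
    (∫ x, ζ x ∂μ) ^ q * (∫ x, ζ x ^ (q / (q - 1)) * S x ∂μ) ^ (1 - q)
      ≤ ∫ x, S x ^ (1 - q) ∂μ := by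
  have hq0 : 0 < q := by linarith
  have hq1 : 0 < q - 1 := by linarith
  have hconj : (q / (q - 1)).HolderConjugate q := (Real.HolderConjugate.conjExponent hq).symm
  set a := q / (q - 1) with ha
  have ha0 : 0 < a := hconj.pos
  have hfa (x : X) : (ζ x * S x ^ (1 / a)) ^ a = ζ x ^ a * S x := by
    rw [mul_rpow (hζ0 x) (rpow_nonneg (hS0 x).le _), ← rpow_mul (hS0 x).le,
      one_div_mul_cancel ha0.ne', rpow_one]
  have hgq (x : X) : (S x ^ (-(1 / a))) ^ q = S x ^ (1 - q) := by
    rw [← rpow_mul (hS0 x).le]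
    congr 1
    rw [ha]
    field_simp
    ring
  have hfg (x : X) : ζ x * S x ^ (1 / a) * S x ^ (-(1 / a)) = ζ x := by
    rw [mul_assoc, ← rpow_add (hS0 x), add_neg_cancel, rpow_zero, mul_one]
  have hf0 (x : X) : 0 ≤ ζ x * S x ^ (1 / a) := mul_nonneg (hζ0 x) (rpow_nonneg (hS0 x).le _)
  have hg0 (x : X) : 0 ≤ S x ^ (-(1 / a)) := rpow_nonneg (hS0 x).le _
  have holder := integral_mul_le_Lp_mul_Lq_of_nonneg (μ := μ) hconj
    (Eventually.of_forall hf0) (Eventually.of_forall hg0)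
    (memLp_ofReal_of_integrable_rpow ha0 (hζ.mul (hS.pow_const _)) hf0
      (by simpa only [hfa] using hint))
    (memLp_ofReal_of_integrable_rpow hq0 (hS.pow_const _) hg0 (by simpa only [hgq] using hSint))
  simp only [hfa, hgq, hfg] at holder
  set K := ∫ x, ζ x ^ a * S x ∂μ
  have hI0 : 0 ≤ ∫ x, S x ^ (1 - q) ∂μ := integral_nonneg fun x => rpow_nonneg (hS0 x).le _
  set I := ∫ x, S x ^ (1 - q) ∂μ
  have hexp : 1 / a * q = q - 1 := by
    rw [ha]
    field_simp
  calc (∫ x, ζ x ∂μ) ^ q * K ^ (1 - q)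
      ≤ (K ^ (1 / a) * I ^ (1 / q)) ^ q * K ^ (1 - q) := by
        gcongr
        exact integral_nonneg hζ0
    _ = K ^ (q - 1) * K ^ (1 - q) * I := by
        rw [mul_rpow (rpow_nonneg hpos.le _) (rpow_nonneg hI0 _), ← rpow_mul hpos.le,
          ← rpow_mul hI0, hexp, one_div_mul_cancel hq0.ne', rpow_one]
        ring
    _ = I := by
        rw [← rpow_add hpos, sub_add_sub_cancel, sub_self, rpow_zero, one_mul]

/-- `B_p^{(1)}` is the tightest bound of the first class: every member of the
class is dominated by `∫ S^{1-p} dμ` (with `S = ∑_i p_i^{1/(1-p)}`), and equality holds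
for the choice `ζ = S^{1-p}`. -/
theorem B1_is_tightest
    {X : Type*} [MeasurableSpace X] (μ : Measure X) [IsProbabilityMeasure μ]
    {M : ℕ} (hM : 2 ≤ M) (p : Fin M → X → ℝ)
    (hpmeas : ∀ i, Measurable (p i))
    (hppos : ∀ i x, 0 < p i x)
    (hpsum : ∀ᵐ x ∂μ, ∑ i, p i x = 1)
    (q : ℝ) (hq : 1 < q)
    (ζ : X → ℝ) (hζmeas : Measurable ζ) (hζnonneg : ∀ x, 0 ≤ ζ x)
    (hζint : Integrable ζ μ)
    (hint : Integrable (fun x => ζ x ^ (q / (q - 1)) * ∑ i, p i x ^ (1 / (1 - q))) μ)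
    (hintpos : 0 < ∫ x, ζ x ^ (q / (q - 1)) * ∑ i, p i x ^ (1 / (1 - q)) ∂μ) :
    (∫ x, ζ x ∂μ) ^ q *
        (∫ x, ζ x ^ (q / (q - 1)) * ∑ i, p i x ^ (1 / (1 - q)) ∂μ) ^ (1 - q)
      ≤ ∫ x, (∑ i, p i x ^ (1 / (1 - q))) ^ (1 - q) ∂μ
    ∧
    (∫ x, (∑ i, p i x ^ (1 / (1 - q))) ^ (1 - q) ∂μ) ^ q *
        (∫ x, ((∑ i, p i x ^ (1 / (1 - q))) ^ (1 - q)) ^ (q / (q - 1)) *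
          ∑ i, p i x ^ (1 / (1 - q)) ∂μ) ^ (1 - q)
      = ∫ x, (∑ i, p i x ^ (1 / (1 - q))) ^ (1 - q) ∂μ := by
  have hS0 (x : X) : 0 < ∑ i, p i x ^ (1 / (1 - q)) :=
    Finset.sum_pos (fun i _ => rpow_pos_of_pos (hppos i x) _) ⟨⟨0, by omega⟩, Finset.mem_univ _⟩
  have hS : Measurable fun x => ∑ i, p i x ^ (1 / (1 - q)) :=
    Finset.measurable_fun_sum _ fun i _ => (hpmeas i).pow_const _
  have hSint : Integrable (fun x => (∑ i, p i x ^ (1 / (1 - q))) ^ (1 - q)) μ := by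
    refine Integrable.of_bound (hS.pow_const _).aestronglyMeasurable 1 ?_
    filter_upwards [hpsum] with x hx
    rw [Real.norm_of_nonneg (rpow_nonneg (hS0 x).le _)]
    refine rpow_le_one_of_one_le_of_nonpos ?_ (by linarith)
    let i₀ : Fin M := ⟨0, by omega⟩
    have hle : p i₀ x ≤ 1 :=
      hx ▸ Finset.single_le_sum (f := fun i => p i x) (fun i _ => (hppos i x).le)
        (Finset.mem_univ i₀)
    calc (1 : ℝ) ≤ p i₀ x ^ (1 / (1 - q)) :=
          one_le_rpow_of_pos_of_le_one_of_nonpos (hppos i₀ x) hle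
            (one_div_nonpos.mpr (by linarith))
      _ ≤ ∑ i, p i x ^ (1 / (1 - q)) :=
          Finset.single_le_sum (f := fun i => p i x ^ (1 / (1 - q)))
            (fun i _ => rpow_nonneg (hppos i x).le _) (Finset.mem_univ i₀)
  refine ⟨integral_rpow_mul_weighted_rpow_le hq hS hS0 hSint hζmeas hζnonneg hint hintpos, ?_⟩
  have hq1 : q - 1 ≠ 0 := by linarith
  have hpt (x : X) : ((∑ i, p i x ^ (1 / (1 - q))) ^ (1 - q)) ^ (q / (q - 1)) *
      ∑ i, p i x ^ (1 / (1 - q)) = (∑ i, p i x ^ (1 / (1 - q))) ^ (1 - q) := by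
    rw [← rpow_mul (hS0 x).le, ← rpow_add_one (hS0 x).ne']
    congr 1
    field_simp
    ring
  simp only [hpt]
  rw [← rpow_add' (integral_nonneg fun x => rpow_nonneg (hS0 x).le _) (by simp),
    add_sub_cancel, rpow_one]
end

section
/- For every real p > 1 and every measurable ζ : X → (0,∞) such that ζ is μ-integrable and the function x ↦ ζ(x)^{1/(1−p)} T(x) is μ-integrable, where T(x) = ∑_{i=1}^M p_i(x)^{p/(p−1)}, one has ∫_X T(x)^{(p−1)/p} dμ(x) ≤ (∫_X ζ dμ)^{1/p} · (∫_X ζ^{1/(1−p)} T dμ)^{(p−1)/p}; moreover equality holds for the choice ζ(x) = T(x)^{(p−1)/p}. Consequently B_p^{(2)} is the tightest bound in the second class. -/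
open MeasureTheory Real Filter Topology

/-- Hölder's inequality with a positive weight: splitting `T ^ ((q - 1) / q)` as
`ζ ^ (1 / q) * (ζ ^ (1 / (1 - q)) * T) ^ ((q - 1) / q)`. -/
theorem integral_rpow_le_weighted {X : Type*} [MeasurableSpace X] {μ : Measure X} {q : ℝ}
    (hq : 1 < q) {ζ T : X → ℝ} (hζpos : ∀ x, 0 < ζ x) (hTnonneg : ∀ x, 0 ≤ T x)
    (hζint : Integrable ζ μ) (hint : Integrable (fun x => ζ x ^ (1 / (1 - q)) * T x) μ) :
    ∫ x, T x ^ ((q - 1) / q) ∂μ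
      ≤ (∫ x, ζ x ∂μ) ^ (1 / q) * (∫ x, ζ x ^ (1 / (1 - q)) * T x ∂μ) ^ ((q - 1) / q) := by
  have hq0 : q ≠ 0 := by linarith
  have hq1 : q - 1 ≠ 0 := by linarith
  have hq1' : 1 - q ≠ 0 := by linarith
  have hconj : q.HolderConjugate (q / (q - 1)) := Real.HolderConjugate.conjExponent hq
  have hr : 0 < q / (q - 1) := hconj.symm.pos
  set g : X → ℝ := fun x => ζ x ^ (1 / (1 - q)) * T x with hg
  have hgnonneg : ∀ x, 0 ≤ g x := fun x =>
    mul_nonneg (rpow_nonneg (hζpos x).le _) (hTnonneg x)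
  have memLp_root : ∀ {f : X → ℝ} {r : ℝ}, 0 < r → (∀ x, 0 ≤ f x) → Integrable f μ →
      MemLp (fun x => f x ^ (1 / r)) (ENNReal.ofReal r) μ := by
    intro f r hr hf hfi
    have hm : AEStronglyMeasurable (fun x => f x ^ (1 / r)) μ :=
      (hfi.aemeasurable.pow_const _).aestronglyMeasurable
    rw [← integrable_norm_rpow_iff hm (by simpa using hr) ENNReal.ofReal_ne_top,
      ENNReal.toReal_ofReal hr.le]
    refine hfi.congr (.of_forall fun x => ?_)
    simp only [Real.norm_of_nonneg (rpow_nonneg (hf x) _)]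
    rw [← rpow_mul (hf x), one_div_mul_cancel hr.ne', rpow_one]
  have key := integral_mul_le_Lp_mul_Lq_of_nonneg hconj
    (.of_forall fun x => rpow_nonneg (hζpos x).le (1 / q))
    (.of_forall fun x => rpow_nonneg (hgnonneg x) (1 / (q / (q - 1))))
    (memLp_root hconj.pos (fun x => (hζpos x).le) hζint) (memLp_root hr hgnonneg hint)
  have root_rpow : ∀ {a r : ℝ}, 0 ≤ a → r ≠ 0 → (a ^ (1 / r)) ^ r = a := by
    intro a r ha hr
    rw [← rpow_mul ha, one_div_mul_cancel hr, rpow_one]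
  simp only [root_rpow (hζpos _).le hq0, root_rpow (hgnonneg _) hr.ne'] at key
  simp only [one_div_div] at key
  refine le_of_eq_of_le (integral_congr_ae (.of_forall fun x => ?_)) key
  have hexp : 1 / q + 1 / (1 - q) * ((q - 1) / q) = 0 := by
    field_simp
    ring
  simp only [hg]
  rw [mul_rpow (rpow_nonneg (hζpos x).le _) (hTnonneg x), ← rpow_mul (hζpos x).le, ← mul_assoc,
    ← rpow_add (hζpos x), hexp, rpow_zero, one_mul]

/-- `B_p^{(2)}` is the tightest bound of the second class: every member of the
class is dominated by the bound built from `∫ T^{(p-1)/p} dμ` (with `T = ∑_i p_i^{p/(p-1)}`),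
and equality holds for the choice `ζ = T^{(p-1)/p}`. -/
theorem B2_is_tightest
    {X : Type*} [MeasurableSpace X] (μ : Measure X) [IsProbabilityMeasure μ]
    {M : ℕ} (hM : 2 ≤ M) (p : Fin M → X → ℝ)
    (hpmeas : ∀ i, Measurable (p i))
    (hppos : ∀ i x, 0 < p i x)
    (hpsum : ∀ᵐ x ∂μ, ∑ i, p i x = 1)
    (q : ℝ) (hq : 1 < q)
    (ζ : X → ℝ) (hζmeas : Measurable ζ) (hζpos : ∀ x, 0 < ζ x)
    (hζint : Integrable ζ μ)
    (hint : Integrable (fun x => ζ x ^ (1 / (1 - q)) * ∑ i, p i x ^ (q / (q - 1))) μ) :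
    ∫ x, (∑ i, p i x ^ (q / (q - 1))) ^ ((q - 1) / q) ∂μ
      ≤ (∫ x, ζ x ∂μ) ^ (1 / q) *
          (∫ x, ζ x ^ (1 / (1 - q)) * ∑ i, p i x ^ (q / (q - 1)) ∂μ) ^ ((q - 1) / q)
    ∧
    ∫ x, (∑ i, p i x ^ (q / (q - 1))) ^ ((q - 1) / q) ∂μ
      = (∫ x, (∑ i, p i x ^ (q / (q - 1))) ^ ((q - 1) / q) ∂μ) ^ (1 / q) *
          (∫ x, ((∑ i, p i x ^ (q / (q - 1))) ^ ((q - 1) / q)) ^ (1 / (1 - q)) *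
            ∑ i, p i x ^ (q / (q - 1)) ∂μ) ^ ((q - 1) / q) := by
  have : Nonempty (Fin M) := ⟨⟨0, by omega⟩⟩
  have hTpos : ∀ x, 0 < ∑ i, p i x ^ (q / (q - 1)) := fun x =>
    Finset.sum_pos (fun i _ => rpow_pos_of_pos (hppos i x) _) Finset.univ_nonempty
  refine ⟨integral_rpow_le_weighted hq hζpos (fun x => (hTpos x).le) hζint hint, ?_⟩
  have hq0 : q ≠ 0 := by linarith
  have hq1 : 1 - q ≠ 0 := by linarith
  have hopt : ∀ x, ((∑ i, p i x ^ (q / (q - 1))) ^ ((q - 1) / q)) ^ (1 / (1 - q)) *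
      ∑ i, p i x ^ (q / (q - 1)) = (∑ i, p i x ^ (q / (q - 1))) ^ ((q - 1) / q) := by
    intro x
    have hexp : (q - 1) / q * (1 / (1 - q)) + 1 = (q - 1) / q := by
      field_simp
      ring
    rw [← rpow_mul (hTpos x).le, ← rpow_add_one (hTpos x).ne', hexp]
  have hsum : 1 / q + (q - 1) / q = 1 := by
    field_simp
    ring
  simp only [hopt]
  rw [← rpow_add' (integral_nonneg fun x => rpow_nonneg (hTpos x).le _)
    (hsum.trans_ne one_ne_zero),
    hsum, rpow_one]
end

section
/- In the binary case M = 2, the limit as p → 1⁺ of B_p^{(1)} = ∫_X (p_1(x)^{1/(1−p)} + p_2(x)^{1/(1−p)})^{1−p} dμ(x) equals ∫_X min(p_1(x), p_2(x)) dμ(x) = 1 − ∫_X max(p_1(x), p_2(x)) dμ(x); that is, the first class of bounds attains the minimum (MAP) probability of error in the limit p → 1⁺. -/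
open MeasureTheory Real Filter Topology

/-- The power sum `(a ^ (1 / (1 - q)) + b ^ (1 / (1 - q))) ^ (1 - q)` with `q > 1` lies between
`2 ^ (1 - q) * min a b` and `min a b`. -/
theorem rpow_add_rpow_mem_Icc_min {a b q : ℝ} (ha : 0 < a) (hb : 0 < b) (hq : 1 < q) :
    (a ^ (1 / (1 - q)) + b ^ (1 / (1 - q))) ^ (1 - q) ∈
      Set.Icc (2 ^ (1 - q) * min a b) (min a b) := by
  wlog hab : a ≤ b generalizing a b
  · rw [add_comm, min_comm]
    exact this hb ha (le_of_not_ge hab)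
  have hneg : 1 - q < 0 := by linarith
  have hpow : (a ^ (1 / (1 - q))) ^ (1 - q) = a := by
    rw [← rpow_mul ha.le, one_div_mul_cancel hneg.ne, rpow_one]
  have ha' : 0 < a ^ (1 / (1 - q)) := rpow_pos_of_pos ha _
  have hb' : 0 < b ^ (1 / (1 - q)) := rpow_pos_of_pos hb _
  have hle : b ^ (1 / (1 - q)) ≤ a ^ (1 / (1 - q)) :=
    rpow_le_rpow_of_nonpos ha hab (one_div_neg.2 hneg).le
  rw [min_eq_left hab]
  constructor
  · calc 2 ^ (1 - q) * a = (2 * a ^ (1 / (1 - q))) ^ (1 - q) := by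
          rw [mul_rpow zero_le_two ha'.le, hpow]
      _ ≤ _ := rpow_le_rpow_of_nonpos (by positivity) (by linarith) hneg.le
  · calc _ ≤ (a ^ (1 / (1 - q))) ^ (1 - q) :=
          rpow_le_rpow_of_nonpos ha' (by linarith) hneg.le
      _ = a := hpow

theorem tendsto_rpow_add_rpow_min {a b : ℝ} (ha : 0 < a) (hb : 0 < b) :
    Tendsto (fun q : ℝ => (a ^ (1 / (1 - q)) + b ^ (1 / (1 - q))) ^ (1 - q))
      (𝓝[>] 1) (𝓝 (min a b)) := by
  have hlow : Tendsto (fun q : ℝ => (2 : ℝ) ^ (1 - q) * min a b) (𝓝[>] 1) (𝓝 (min a b)) := by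
    have hcont : Continuous fun q : ℝ => (2 : ℝ) ^ (1 - q) * min a b :=
      (continuous_const.rpow (by fun_prop) fun _ => Or.inl two_ne_zero).mul continuous_const
    simpa using (hcont.tendsto 1).mono_left nhdsWithin_le_nhds
  refine tendsto_of_tendsto_of_tendsto_of_le_of_le' hlow tendsto_const_nhds ?_ ?_ <;>
    filter_upwards [self_mem_nhdsWithin] with q hq
  · exact (rpow_add_rpow_mem_Icc_min ha hb hq).1
  · exact (rpow_add_rpow_mem_Icc_min ha hb hq).2

/-- in the binary case, `B_p^{(1)} → ∫ min(p₁,p₂) dμ = 1 - ∫ max(p₁,p₂) dμ`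
as `p → 1⁺`; i.e. the first class attains the MAP probability of error in the limit. -/
theorem B1_tendsto_MAP_error_binary
    {X : Type*} [MeasurableSpace X] (μ : Measure X) [IsProbabilityMeasure μ]
    (p₁ p₂ : X → ℝ) (h₁meas : Measurable p₁) (h₂meas : Measurable p₂)
    (h₁pos : ∀ x, 0 < p₁ x) (h₂pos : ∀ x, 0 < p₂ x)
    (hsum : ∀ᵐ x ∂μ, p₁ x + p₂ x = 1) :
    Tendsto (fun q : ℝ =>
        ∫ x, (p₁ x ^ (1 / (1 - q)) + p₂ x ^ (1 / (1 - q))) ^ (1 - q) ∂μ)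
      (𝓝[>] (1 : ℝ)) (𝓝 (∫ x, min (p₁ x) (p₂ x) ∂μ))
    ∧ ∫ x, min (p₁ x) (p₂ x) ∂μ = 1 - ∫ x, max (p₁ x) (p₂ x) ∂μ := by
  constructor
  · refine tendsto_integral_filter_of_dominated_convergence (fun _ => 1) ?_ ?_
      (integrable_const 1) (ae_of_all _ fun x => tendsto_rpow_add_rpow_min (h₁pos x) (h₂pos x))
    · exact Eventually.of_forall fun q => Measurable.aestronglyMeasurable (by fun_prop)
    · filter_upwards [self_mem_nhdsWithin] with q hq
      filter_upwards [hsum] with x hx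
      have h₁ := h₁pos x
      have h₂ := h₂pos x
      rw [norm_of_nonneg (by positivity)]
      have hmin := (rpow_add_rpow_mem_Icc_min h₁ h₂ hq).2
      linarith [min_le_left (p₁ x) (p₂ x)]
  · have hmax : Integrable (fun x => max (p₁ x) (p₂ x)) μ := by
      refine .of_bound (h₁meas.max h₂meas).aestronglyMeasurable 1 ?_
      filter_upwards [hsum] with x hx
      have h₁ := h₁pos x
      have h₂ := h₂pos x
      rw [norm_of_nonneg (by positivity)]
      exact max_le (by linarith) (by linarith)
    calc ∫ x, min (p₁ x) (p₂ x) ∂μ = ∫ x, (1 - max (p₁ x) (p₂ x)) ∂μ := by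
          refine integral_congr_ae ?_
          filter_upwards [hsum] with x hx
          linarith [min_add_max (p₁ x) (p₂ x)]
      _ = 1 - ∫ x, max (p₁ x) (p₂ x) ∂μ := by
          rw [integral_sub (integrable_const 1) hmax]
          simp
end

section
/- The limit as p → 1⁺ of B_p^{(2)} = 1 − ∫_X (∑_{i=1}^M p_i(x)^{p/(p−1)})^{(p−1)/p} dμ(x) equals 1 − ∫_X max_{1≤i≤M} p_i(x) dμ(x), the minimum (MAP) probability of error; that is, the second class of bounds attains P_e^min in the limit p → 1⁺ for every number of hypotheses M. -/
open MeasureTheory Real Filter Topology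

lemma iSup_le_sum_rpow_rpow_inv {ι : Type*} [Fintype ι] [Nonempty ι] {a : ι → ℝ}
    (ha : ∀ i, 0 ≤ a i) {s : ℝ} (hs : 0 < s) :
    ⨆ i, a i ≤ (∑ i, a i ^ s) ^ s⁻¹ := by
  refine ciSup_le fun i => ?_
  calc a i = (a i ^ s) ^ s⁻¹ := (rpow_rpow_inv (ha i) hs.ne').symm
    _ ≤ (∑ i, a i ^ s) ^ s⁻¹ := by
      refine rpow_le_rpow (rpow_nonneg (ha i) s) ?_ (inv_nonneg.2 hs.le)
      exact Finset.single_le_sum (f := fun i => a i ^ s)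
        (fun j _ => rpow_nonneg (ha j) s) (Finset.mem_univ i)

lemma sum_rpow_rpow_inv_le_card_rpow_mul {ι : Type*} [Fintype ι] {a : ι → ℝ} {b : ℝ}
    (ha : ∀ i, 0 ≤ a i) (hb : 0 ≤ b) (hab : ∀ i, a i ≤ b) {s : ℝ} (hs : 0 < s) :
    (∑ i, a i ^ s) ^ s⁻¹ ≤ (Fintype.card ι : ℝ) ^ s⁻¹ * b := by
  calc (∑ i, a i ^ s) ^ s⁻¹ ≤ (∑ _i : ι, b ^ s) ^ s⁻¹ := by
        refine rpow_le_rpow (Finset.sum_nonneg fun i _ => rpow_nonneg (ha i) s) ?_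
          (inv_nonneg.2 hs.le)
        exact Finset.sum_le_sum fun i _ => rpow_le_rpow (ha i) (hab i) hs.le
    _ = (Fintype.card ι : ℝ) ^ s⁻¹ * b := by
        rw [Finset.sum_const, Finset.card_univ, nsmul_eq_mul,
          mul_rpow (Nat.cast_nonneg _) (rpow_nonneg hb s), rpow_rpow_inv hb hs.ne']

/-- The `ℓ^s` norm of a finite family of nonnegative reals tends to its maximum as `s → ∞`. -/
lemma tendsto_sum_rpow_rpow_inv_atTop {ι : Type*} [Fintype ι] [Nonempty ι] {a : ι → ℝ}
    (ha : ∀ i, 0 ≤ a i) :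
    Tendsto (fun s : ℝ => (∑ i, a i ^ s) ^ s⁻¹) atTop (𝓝 (⨆ i, a i)) := by
  have hcard : (Fintype.card ι : ℝ) ≠ 0 := Nat.cast_ne_zero.2 Fintype.card_ne_zero
  have hupper : Tendsto (fun s : ℝ => (Fintype.card ι : ℝ) ^ s⁻¹ * ⨆ i, a i) atTop
      (𝓝 (⨆ i, a i)) := by
    simpa using ((tendsto_const_nhds (x := (Fintype.card ι : ℝ))).rpow
      (tendsto_inv_atTop_zero (𝕜 := ℝ)) (Or.inl hcard)).mul_const (⨆ i, a i)
  refine tendsto_of_tendsto_of_tendsto_of_le_of_le' tendsto_const_nhds hupper ?_ ?_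
  · filter_upwards [eventually_gt_atTop 0] with s hs using iSup_le_sum_rpow_rpow_inv ha hs
  · filter_upwards [eventually_gt_atTop 0] with s hs
    exact sum_rpow_rpow_inv_le_card_rpow_mul ha (Real.iSup_nonneg ha)
      (le_ciSup (Set.finite_range a).bddAbove) hs

lemma tendsto_div_sub_one_nhdsGT_one :
    Tendsto (fun q : ℝ => q / (q - 1)) (𝓝[>] 1) atTop := by
  have hsub : Tendsto (fun q : ℝ => q - 1) (𝓝[>] 1) (𝓝[>] 0) := by
    refine tendsto_nhdsWithin_iff.2 ⟨?_, ?_⟩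
    · have : Tendsto (fun q : ℝ => q - 1) (𝓝 1) (𝓝 (1 - 1)) :=
        (continuous_id.sub continuous_const).tendsto 1
      rw [sub_self] at this
      exact this.mono_left nhdsWithin_le_nhds
    · filter_upwards [self_mem_nhdsWithin] with q hq
      exact Set.mem_Ioi.2 (sub_pos.2 (Set.mem_Ioi.1 hq))
  have hid : Tendsto (fun q : ℝ => q) (𝓝[>] 1) (𝓝 1) := nhdsWithin_le_nhds
  simpa only [div_eq_mul_inv, Function.comp_apply] using
    hid.pos_mul_atTop one_pos (tendsto_inv_nhdsGT_zero.comp hsub)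

/-- for every number of hypotheses `M`, `B_p^{(2)}` tends to the
minimum (MAP) probability of error `1 - ∫ max_i p_i dμ` as `p → 1⁺`. -/
theorem B2_tendsto_MAP_error
    {X : Type*} [MeasurableSpace X] (μ : Measure X) [IsProbabilityMeasure μ]
    {M : ℕ} (hM : 2 ≤ M) (p : Fin M → X → ℝ)
    (hpmeas : ∀ i, Measurable (p i))
    (hppos : ∀ i x, 0 < p i x)
    (hpsum : ∀ᵐ x ∂μ, ∑ i, p i x = 1) :
    Tendsto (fun q : ℝ =>
        1 - ∫ x, (∑ i, p i x ^ (q / (q - 1))) ^ ((q - 1) / q) ∂μ)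
      (𝓝[>] (1 : ℝ)) (𝓝 (1 - ∫ x, ⨆ i, p i x ∂μ)) := by
  have : Nonempty (Fin M) := ⟨⟨0, by omega⟩⟩
  have key : Tendsto (fun s : ℝ => ∫ x, (∑ i, p i x ^ s) ^ s⁻¹ ∂μ) atTop
      (𝓝 (∫ x, ⨆ i, p i x ∂μ)) := by
    refine tendsto_integral_filter_of_dominated_convergence (fun _ => (M : ℝ)) ?_ ?_
      (integrable_const _) ?_
    · refine Eventually.of_forall fun s => Measurable.aestronglyMeasurable ?_
      exact (Finset.measurable_sum _ fun i _ => (hpmeas i).pow_const s).pow_const s⁻¹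
    · filter_upwards [eventually_ge_atTop 1] with s hs
      filter_upwards [hpsum] with x hx
      have hs0 : 0 < s := one_pos.trans_le hs
      have hle : ∀ i, p i x ≤ 1 := fun i => hx ▸
        Finset.single_le_sum (f := fun i => p i x) (fun j _ => (hppos j x).le)
          (Finset.mem_univ i)
      rw [norm_of_nonneg (rpow_nonneg
        (Finset.sum_nonneg fun i _ => rpow_nonneg (hppos i x).le s) _)]
      have hM1 : (1 : ℝ) ≤ M := by exact_mod_cast (by omega : 1 ≤ M)
      calc (∑ i, p i x ^ s) ^ s⁻¹ ≤ (Fintype.card (Fin M) : ℝ) ^ s⁻¹ * 1 :=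
            sum_rpow_rpow_inv_le_card_rpow_mul (fun i => (hppos i x).le) zero_le_one hle hs0
        _ = (M : ℝ) ^ s⁻¹ := by rw [Fintype.card_fin, mul_one]
        _ ≤ M := rpow_le_self_of_one_le hM1 (inv_le_one_of_one_le₀ hs)
    · exact Eventually.of_forall fun x =>
        tendsto_sum_rpow_rpow_inv_atTop fun i => (hppos i x).le
  refine tendsto_const_nhds.sub ?_
  simpa only [Function.comp_def, inv_div] using key.comp tendsto_div_sub_one_nhdsGT_one
end

section
/- For every detector d, the probability of error satisfies the Bayesian lower bound P_e(d) ≥ 1 − ∫_X √(∑_{i=1}^M p_i(x)²) dμ(x) (this is the bound B_p^{(2)} of the second class with p = 2). -/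
open MeasureTheory Real Filter Topology

/-- the Bayesian lower bound (the bound `B_2^{(2)}` of the second class
with `p = 2`): `P_e(d) ≥ 1 - ∫ √(∑ p_i²) dμ`. -/
theorem bayesian_lower_bound
    {X : Type*} [MeasurableSpace X] (μ : Measure X) [IsProbabilityMeasure μ]
    {M : ℕ} (hM : 2 ≤ M) (p : Fin M → X → ℝ)
    (hpmeas : ∀ i, Measurable (p i))
    (hppos : ∀ i x, 0 < p i x)
    (hpsum : ∀ᵐ x ∂μ, ∑ i, p i x = 1)
    (d : X → Fin M) (hd : Measurable d) :
    1 - ∫ x, Real.sqrt (∑ i, (p i x) ^ 2) ∂μ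
      ≤ ∫ x, (1 - p (d x) x) ∂μ := by
  have hle : ∀ i x, p i x ≤ √(∑ j, (p j x) ^ 2) := fun i x =>
    Real.le_sqrt_of_sq_le
      (Finset.single_le_sum (f := fun j => (p j x) ^ 2) (fun j _ => sq_nonneg _)
        (Finset.mem_univ i))
  have hle_one : ∀ᵐ x ∂μ, √(∑ j, (p j x) ^ 2) ≤ 1 := by
    filter_upwards [hpsum] with x hx
    refine Real.sqrt_le_one.mpr ?_
    calc ∑ j, (p j x) ^ 2 ≤ (∑ j, p j x) ^ 2 :=
          Finset.sum_sq_le_sq_sum_of_nonneg fun j _ => (hppos j x).le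
      _ = 1 := by rw [hx, one_pow]
  have hsqrt : Integrable (fun x => √(∑ j, (p j x) ^ 2)) μ := by
    refine Integrable.of_bound (C := 1) (Measurable.aestronglyMeasurable (by fun_prop)) ?_
    filter_upwards [hle_one] with x hx
    rwa [Real.norm_of_nonneg (Real.sqrt_nonneg _)]
  have hmeas : Measurable fun x => p (d x) x :=
    (measurable_from_prod_countable_right (f := fun q : Fin M × X => p q.1 q.2) hpmeas).comp
      (hd.prodMk measurable_id)
  have hdet : Integrable (fun x => p (d x) x) μ := by
    refine hsqrt.mono' hmeas.aestronglyMeasurable (Eventually.of_forall fun x => ?_)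
    rw [Real.norm_of_nonneg (hppos _ _).le]
    exact hle _ x
  rw [integral_sub (integrable_const 1) hdet, integral_const, probReal_univ, one_smul]
  exact sub_le_sub_left (integral_mono hdet hsqrt fun x => hle _ x) 1
end

section
/- For every detector d, the probability of error satisfies P_e(d) ≥ 1 − √(∫_X ∑_{i=1}^M p_i(x)² dμ(x)) (this is the Jensen-simplified bound JB_2^{(2)}). -/
open MeasureTheory Real Filter Topology

/-- the Jensen-simplified Bayesian lower bound `JB_2^{(2)}`:
`P_e(d) ≥ 1 - √(∫ ∑ p_i² dμ)`. -/
theorem bayesian_lower_bound_jensen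
    {X : Type*} [MeasurableSpace X] (μ : Measure X) [IsProbabilityMeasure μ]
    {M : ℕ} (hM : 2 ≤ M) (p : Fin M → X → ℝ)
    (hpmeas : ∀ i, Measurable (p i))
    (hppos : ∀ i x, 0 < p i x)
    (hpsum : ∀ᵐ x ∂μ, ∑ i, p i x = 1)
    (d : X → Fin M) (hd : Measurable d) :
    1 - Real.sqrt (∫ x, ∑ i, (p i x) ^ 2 ∂μ)
      ≤ ∫ x, (1 - p (d x) x) ∂μ := by
  have hfm : Measurable fun x => p (d x) x :=
    (measurable_from_prod_countable_right (f := fun q : Fin M × X => p q.1 q.2) hpmeas).comp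
      (hd.prodMk measurable_id)
  have hle : ∀ᵐ x ∂μ, ∀ i, p i x ≤ 1 := by
    filter_upwards [hpsum] with x hx i
    rw [← hx]
    exact Finset.single_le_sum (f := fun j => p j x) (fun j _ => (hppos j x).le)
      (Finset.mem_univ i)
  have hfi : Integrable (fun x => p (d x) x) μ := by
    refine Integrable.of_bound hfm.aestronglyMeasurable 1 ?_
    filter_upwards [hle] with x hx
    rw [Real.norm_of_nonneg (hppos _ x).le]
    exact hx _
  have hsq : ∀ {g : X → ℝ}, Measurable g → (∀ᵐ x ∂μ, 0 ≤ g x ∧ g x ≤ 1) →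
      Integrable (fun x => g x ^ 2) μ := by
    intro g hg hb
    refine Integrable.of_bound (hg.pow_const 2).aestronglyMeasurable 1 ?_
    filter_upwards [hb] with x hx
    rw [Real.norm_of_nonneg (sq_nonneg _)]
    exact pow_le_one₀ hx.1 hx.2
  have hf2 : Integrable (fun x => p (d x) x ^ 2) μ :=
    hsq hfm (hle.mono fun x hx => ⟨(hppos _ x).le, hx _⟩)
  have hs2 : Integrable (fun x => ∑ i, p i x ^ 2) μ :=
    integrable_finsetSum _ fun i _ =>
      hsq (hpmeas i) (hle.mono fun x hx => ⟨(hppos _ x).le, hx _⟩)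
  have hjensen : (∫ x, p (d x) x ∂μ) ^ 2 ≤ ∫ x, p (d x) x ^ 2 ∂μ :=
    (convexOn_pow 2).map_integral_le (continuous_pow 2).continuousOn isClosed_Ici
      (Eventually.of_forall fun x => (hppos _ x).le) hfi hf2
  have hmono : ∫ x, p (d x) x ^ 2 ∂μ ≤ ∫ x, ∑ i, p i x ^ 2 ∂μ :=
    integral_mono hf2 hs2 fun x =>
      Finset.single_le_sum (f := fun j => p j x ^ 2) (fun j _ => sq_nonneg _)
        (Finset.mem_univ (d x))
  rw [integral_sub (integrable_const 1) hfi, integral_const, probReal_univ, one_smul]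
  exact sub_le_sub_left (Real.le_sqrt_of_sq_le (hjensen.trans hmono)) 1
end

section
/- (Theorem 1, necessity.) Let v : X × {1,…,M} → [0,∞) be measurable with x ↦ p_i(x) v(x,i) μ-integrable for each i, and suppose the error-weighted expectation ∫_X ∑_{i : i ≠ d(x)} p_i(x) v(x, i) dμ(x) takes the same value for every detector d. Then for μ-a.e. x the quantity p_i(x) v(x, i) does not depend on i; that is, there is a function ζ : X → [0,∞) such that v(x, i) = ζ(x)/p_i(x) for all i = 1,…,M, for μ-a.e. x. -/
open MeasureTheory Real Filter Topology

/-- If the integral of the sum of all `f i x` except the one selected by a measurable `d` does not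
depend on `d`, then the integrable functions `f i` agree almost everywhere. -/
theorem ae_eq_of_integral_sum_erase_eq {X ι : Type*} [MeasurableSpace X] {μ : Measure X}
    [Fintype ι] [DecidableEq ι] [MeasurableSpace ι] {f : ι → X → ℝ}
    (hf : ∀ i, Integrable (f i) μ)
    (hconst : ∀ d₁ d₂ : X → ι, Measurable d₁ → Measurable d₂ →
      ∫ x, ∑ i ∈ Finset.univ.erase (d₁ x), f i x ∂μ
        = ∫ x, ∑ i ∈ Finset.univ.erase (d₂ x), f i x ∂μ) (i j : ι) :
    f i =ᵐ[μ] f j := by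
  classical
  refine Integrable.ae_eq_of_forall_setIntegral_eq _ _ (hf i) (hf j) fun s hs _ => ?_
  have h := hconst (s.piecewise (fun _ => i) fun _ => j) (fun _ => j)
    (measurable_const.piecewise hs measurable_const) measurable_const
  have hpt : ∀ x, ∑ k ∈ Finset.univ.erase (s.piecewise (fun _ => i) (fun _ => j) x), f k x
      = ∑ k ∈ Finset.univ.erase j, f k x + s.indicator (fun x => f j x - f i x) x := by
    intro x
    have hi := Finset.sum_erase_add Finset.univ (fun k => f k x) (Finset.mem_univ i)
    have hj := Finset.sum_erase_add Finset.univ (fun k => f k x) (Finset.mem_univ j)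
    by_cases hx : x ∈ s
    · simp only [Set.piecewise_eq_of_mem _ _ _ hx, Set.indicator_of_mem hx]
      linarith
    · simp only [Set.piecewise_eq_of_notMem _ _ _ hx, Set.indicator_of_notMem hx, add_zero]
  have hind : Integrable (s.indicator fun x => f j x - f i x) μ :=
    ((hf j).sub (hf i)).indicator hs
  simp_rw [hpt] at h
  rw [integral_add (integrable_finsetSum _ fun k _ => hf k) hind, integral_indicator hs,
    integral_sub (hf j).integrableOn (hf i).integrableOn] at h
  linarith

/-- Theorem 1, necessity: if the error-weighted expectation of `v` is
the same for every detector, then a.e. `p_i(x) v(x,i)` does not depend on `i`; i.e.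
there is `ζ` with `v(x,i) = ζ(x)/p_i(x)` for all `i`, for a.e. `x`. -/
theorem error_weighted_expectation_independence_necessity
    {X : Type*} [MeasurableSpace X] (μ : Measure X) [IsProbabilityMeasure μ]
    {M : ℕ} (hM : 2 ≤ M) (p : Fin M → X → ℝ)
    (hpmeas : ∀ i, Measurable (p i))
    (hppos : ∀ i x, 0 < p i x)
    (hpsum : ∀ᵐ x ∂μ, ∑ i, p i x = 1)
    (v : X → Fin M → ℝ)
    (hvmeas : ∀ i, Measurable fun x => v x i)
    (hvnonneg : ∀ x i, 0 ≤ v x i)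
    (hvint : ∀ i, Integrable (fun x => p i x * v x i) μ)
    (hconst : ∀ d₁ d₂ : X → Fin M, Measurable d₁ → Measurable d₂ →
      ∫ x, ∑ i ∈ Finset.univ.erase (d₁ x), p i x * v x i ∂μ
        = ∫ x, ∑ i ∈ Finset.univ.erase (d₂ x), p i x * v x i ∂μ) :
    (∀ᵐ x ∂μ, ∀ i j : Fin M, p i x * v x i = p j x * v x j)
    ∧ ∃ ζ : X → ℝ, (∀ x, 0 ≤ ζ x) ∧ ∀ᵐ x ∂μ, ∀ i, v x i = ζ x / p i x := by
  have hall : ∀ᵐ x ∂μ, ∀ i j : Fin M, p i x * v x i = p j x * v x j :=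
    ae_all_iff.2 fun i => ae_all_iff.2 fun j =>
      ae_eq_of_integral_sum_erase_eq (f := fun i x => p i x * v x i) hvint hconst i j
  let k : Fin M := ⟨0, by omega⟩
  refine ⟨hall, fun x => p k x * v x k,
    fun x => mul_nonneg (hppos k x).le (hvnonneg x k), ?_⟩
  filter_upwards [hall] with x hx i
  rw [eq_div_iff (hppos i x).ne', mul_comm]
  exact hx i k
end

section
/- In the binary case M = 2, for every real p > 1 the minimum (MAP) probability of error satisfies the upper bound P_e^min = 1 − ∫_X max(p_1(x), p_2(x)) dμ(x) ≤ 2^{p−1} ∫_X (p_1(x)^{1/(1−p)} + p_2(x)^{1/(1−p)})^{1−p} dμ(x); i.e., the upper bound is 2^{p−1} times the lower bound B_p^{(1)}. -/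
open MeasureTheory Real Filter Topology

/-- Raising to the powers `1 / (1 - q)` and `1 - q` are mutually inverse operations. -/
lemma rpow_one_div_one_sub_rpow {a q : ℝ} (ha : 0 < a) (hq : 1 < q) :
    (a ^ (1 / (1 - q))) ^ (1 - q) = a := by
  rw [← Real.rpow_mul ha.le, one_div_mul_cancel (by linarith), Real.rpow_one]

lemma rpow_add_rpow_le_left {a b q : ℝ} (ha : 0 < a) (hb : 0 < b) (hq : 1 < q) :
    (a ^ (1 / (1 - q)) + b ^ (1 / (1 - q))) ^ (1 - q) ≤ a := by
  have hb' := Real.rpow_pos_of_pos hb (1 / (1 - q))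
  calc (a ^ (1 / (1 - q)) + b ^ (1 / (1 - q))) ^ (1 - q)
      ≤ (a ^ (1 / (1 - q))) ^ (1 - q) :=
        Real.rpow_le_rpow_of_nonpos (Real.rpow_pos_of_pos ha _) (by linarith) (by linarith)
    _ = a := rpow_one_div_one_sub_rpow ha hq

lemma min_le_two_rpow_mul {a b q : ℝ} (ha : 0 < a) (hb : 0 < b) (hq : 1 < q) :
    min a b ≤ 2 ^ (q - 1) * (a ^ (1 / (1 - q)) + b ^ (1 / (1 - q))) ^ (1 - q) := by
  have hm : 0 < min a b := lt_min ha hb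
  have hexp : 1 / (1 - q) ≤ 0 := one_div_nonpos.mpr (by linarith)
  have hle : a ^ (1 / (1 - q)) + b ^ (1 / (1 - q)) ≤ 2 * min a b ^ (1 / (1 - q)) := by
    linarith [Real.rpow_le_rpow_of_nonpos hm (min_le_left a b) hexp,
      Real.rpow_le_rpow_of_nonpos hm (min_le_right a b) hexp]
  calc min a b
      = 2 ^ (q - 1) * (2 * min a b ^ (1 / (1 - q))) ^ (1 - q) := by
        rw [Real.mul_rpow zero_le_two (Real.rpow_nonneg hm.le _),
          rpow_one_div_one_sub_rpow hm hq, ← mul_assoc, ← Real.rpow_add zero_lt_two]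
        simp
    _ ≤ 2 ^ (q - 1) * (a ^ (1 / (1 - q)) + b ^ (1 / (1 - q))) ^ (1 - q) := by
        gcongr ?_ * ?_
        exact Real.rpow_le_rpow_of_nonpos
          (add_pos (Real.rpow_pos_of_pos ha _) (Real.rpow_pos_of_pos hb _)) hle (by linarith)

/-- in the binary case, the MAP probability of error is upper bounded
by `2^{p-1}` times the lower bound `B_p^{(1)}`. -/
theorem MAP_error_upper_bound_binary
    {X : Type*} [MeasurableSpace X] (μ : Measure X) [IsProbabilityMeasure μ]
    (p₁ p₂ : X → ℝ) (h₁meas : Measurable p₁) (h₂meas : Measurable p₂)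
    (h₁pos : ∀ x, 0 < p₁ x) (h₂pos : ∀ x, 0 < p₂ x)
    (hsum : ∀ᵐ x ∂μ, p₁ x + p₂ x = 1)
    (q : ℝ) (hq : 1 < q) :
    1 - ∫ x, max (p₁ x) (p₂ x) ∂μ
      ≤ (2 : ℝ) ^ (q - 1) *
          ∫ x, (p₁ x ^ (1 / (1 - q)) + p₂ x ^ (1 / (1 - q))) ^ (1 - q) ∂μ := by
  have hmax : Integrable (fun x => max (p₁ x) (p₂ x)) μ := by
    refine Integrable.of_bound (h₁meas.max h₂meas).aestronglyMeasurable 1 ?_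
    filter_upwards [hsum] with x hx
    rw [Real.norm_of_nonneg ((h₁pos x).le.trans (le_max_left _ _))]
    exact max_le (by linarith [h₂pos x]) (by linarith [h₁pos x])
  have hB : Integrable
      (fun x => (p₁ x ^ (1 / (1 - q)) + p₂ x ^ (1 / (1 - q))) ^ (1 - q)) μ := by
    refine Integrable.of_bound (Measurable.aestronglyMeasurable (by fun_prop)) 1 ?_
    filter_upwards [hsum] with x hx
    rw [Real.norm_of_nonneg (Real.rpow_nonneg (add_nonneg
      (Real.rpow_nonneg (h₁pos x).le _) (Real.rpow_nonneg (h₂pos x).le _)) _)]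
    linarith [rpow_add_rpow_le_left (h₁pos x) (h₂pos x) hq, h₂pos x]
  calc 1 - ∫ x, max (p₁ x) (p₂ x) ∂μ
      = ∫ x, (1 - max (p₁ x) (p₂ x)) ∂μ := by
        rw [integral_sub (integrable_const 1) hmax]
        simp
    _ ≤ ∫ x, 2 ^ (q - 1) * (p₁ x ^ (1 / (1 - q)) + p₂ x ^ (1 / (1 - q))) ^ (1 - q) ∂μ := by
        refine integral_mono_ae ((integrable_const 1).sub hmax) (hB.const_mul _) ?_
        filter_upwards [hsum] with x hx
        have h := min_le_two_rpow_mul (h₁pos x) (h₂pos x) hq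
        linarith [min_add_max (p₁ x) (p₂ x)]
    _ = 2 ^ (q - 1) *
          ∫ x, (p₁ x ^ (1 / (1 - q)) + p₂ x ^ (1 / (1 - q))) ^ (1 - q) ∂μ :=
        integral_const_mul _ _
end

section
/- In the binary case M = 2, the limit as p → 1⁺ of the upper bound 2^{p−1} ∫_X (p_1(x)^{1/(1−p)} + p_2(x)^{1/(1−p)})^{1−p} dμ(x) equals P_e^min = 1 − ∫_X max(p_1(x), p_2(x)) dμ(x); that is, the upper bound coincides with the lower bound B_p^{(1)} (and with the MAP error probability) in the limit p → 1⁺. -/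
open MeasureTheory Real Filter Topology

/-- The power mean `(x ^ (1 / (1 - q)) + y ^ (1 / (1 - q))) ^ (1 - q)` with `q > 1` is at most
the minimum of `x` and `y`. -/
lemma rpow_add_rpow_rpow_le_min {x y q : ℝ} (hx : 0 < x) (hy : 0 < y) (hq : 1 < q) :
    (x ^ (1 / (1 - q)) + y ^ (1 / (1 - q))) ^ (1 - q) ≤ min x y := by
  have hq' : 1 - q < 0 := by linarith
  have cancel {z : ℝ} (hz : 0 < z) : (z ^ (1 / (1 - q))) ^ (1 - q) = z := by
    rw [← rpow_mul hz.le, one_div_mul_cancel hq'.ne, rpow_one]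
  have hx' := rpow_pos_of_pos hx (1 / (1 - q))
  have hy' := rpow_pos_of_pos hy (1 / (1 - q))
  refine le_min ?_ ?_
  · refine (rpow_le_rpow_of_nonpos hx' ?_ hq'.le).trans_eq (cancel hx)
    linarith
  · refine (rpow_le_rpow_of_nonpos hy' ?_ hq'.le).trans_eq (cancel hy)
    linarith

/-- The minimum of `x` and `y` is at most `2 ^ (q - 1)` times their power mean
`(x ^ (1 / (1 - q)) + y ^ (1 / (1 - q))) ^ (1 - q)`, for `q > 1`. -/
lemma min_le_two_rpow_mul_rpow_add_rpow_rpow {x y q : ℝ} (hx : 0 < x) (hy : 0 < y)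
    (hq : 1 < q) :
    min x y ≤ 2 ^ (q - 1) * (x ^ (1 / (1 - q)) + y ^ (1 / (1 - q))) ^ (1 - q) := by
  have hq' : 1 - q < 0 := by linarith
  have hexp : 1 / (1 - q) ≤ 0 := (one_div_neg.mpr hq').le
  have hm : 0 < min x y := lt_min hx hy
  have hx' := rpow_pos_of_pos hx (1 / (1 - q))
  have hy' := rpow_pos_of_pos hy (1 / (1 - q))
  have hle : x ^ (1 / (1 - q)) + y ^ (1 / (1 - q)) ≤ 2 * min x y ^ (1 / (1 - q)) := by
    linarith [rpow_le_rpow_of_nonpos hm (min_le_left x y) hexp,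
      rpow_le_rpow_of_nonpos hm (min_le_right x y) hexp]
  calc min x y = 2 ^ (q - 1) * (2 * min x y ^ (1 / (1 - q))) ^ (1 - q) := by
        rw [mul_rpow zero_le_two (rpow_nonneg hm.le _), ← rpow_mul hm.le,
          one_div_mul_cancel hq'.ne, rpow_one, ← mul_assoc, ← rpow_add two_pos]
        simp
    _ ≤ _ := by
        gcongr 2 ^ (q - 1) * ?_
        exact rpow_le_rpow_of_nonpos (add_pos hx' hy') hle hq'.le

/-- in the binary case the upper bound `2^{p-1} B_p^{(1)}` tends to the
MAP probability of error `1 - ∫ max(p₁,p₂) dμ` as `p → 1⁺`. -/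
theorem upper_bound_tendsto_MAP_error_binary
    {X : Type*} [MeasurableSpace X] (μ : Measure X) [IsProbabilityMeasure μ]
    (p₁ p₂ : X → ℝ) (h₁meas : Measurable p₁) (h₂meas : Measurable p₂)
    (h₁pos : ∀ x, 0 < p₁ x) (h₂pos : ∀ x, 0 < p₂ x)
    (hsum : ∀ᵐ x ∂μ, p₁ x + p₂ x = 1) :
    Tendsto (fun q : ℝ =>
        (2 : ℝ) ^ (q - 1) *
          ∫ x, (p₁ x ^ (1 / (1 - q)) + p₂ x ^ (1 / (1 - q))) ^ (1 - q) ∂μ)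
      (𝓝[>] (1 : ℝ)) (𝓝 (1 - ∫ x, max (p₁ x) (p₂ x) ∂μ)) := by
  have hmax_int : Integrable (fun x => max (p₁ x) (p₂ x)) μ := by
    refine Integrable.of_bound (h₁meas.max h₂meas).aestronglyMeasurable 1 ?_
    filter_upwards [hsum] with x hx
    rw [norm_of_nonneg ((h₁pos x).le.trans (le_max_left _ _))]
    exact max_le (by linarith [h₂pos x]) (by linarith [h₁pos x])
  have hmin_ae : (fun x => min (p₁ x) (p₂ x)) =ᵐ[μ] fun x => 1 - max (p₁ x) (p₂ x) := by
    filter_upwards [hsum] with x hx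
    linarith [min_add_max (p₁ x) (p₂ x)]
  have hmin_int : Integrable (fun x => min (p₁ x) (p₂ x)) μ :=
    ((integrable_const 1).sub hmax_int).congr hmin_ae.symm
  have hmin_eq : ∫ x, min (p₁ x) (p₂ x) ∂μ = 1 - ∫ x, max (p₁ x) (p₂ x) ∂μ := by
    rw [integral_congr_ae hmin_ae, integral_sub (integrable_const 1) hmax_int]
    simp
  rw [← hmin_eq]
  have hint {q : ℝ} (hq : 1 < q) : Integrable
      (fun x => (p₁ x ^ (1 / (1 - q)) + p₂ x ^ (1 / (1 - q))) ^ (1 - q)) μ := by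
    have hmeas := ((h₁meas.pow_const (1 / (1 - q))).add
      (h₂meas.pow_const (1 / (1 - q)))).pow_const (1 - q)
    refine hmin_int.mono' hmeas.aestronglyMeasurable (ae_of_all _ fun x => ?_)
    have hx₁ := rpow_pos_of_pos (h₁pos x) (1 / (1 - q))
    have hx₂ := rpow_pos_of_pos (h₂pos x) (1 / (1 - q))
    rw [norm_of_nonneg (by positivity)]
    exact rpow_add_rpow_rpow_le_min (h₁pos x) (h₂pos x) hq
  have hupper : Tendsto (fun q : ℝ => (2 : ℝ) ^ (q - 1) * ∫ x, min (p₁ x) (p₂ x) ∂μ)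
      (𝓝[>] 1) (𝓝 (∫ x, min (p₁ x) (p₂ x) ∂μ)) := by
    have hcont : Continuous fun q : ℝ => (2 : ℝ) ^ (q - 1) * ∫ x, min (p₁ x) (p₂ x) ∂μ :=
      (continuous_const.rpow (by fun_prop) fun _ => Or.inl two_ne_zero).mul continuous_const
    simpa using (hcont.tendsto 1).mono_left nhdsWithin_le_nhds
  refine tendsto_of_tendsto_of_tendsto_of_le_of_le' tendsto_const_nhds hupper ?_ ?_
  · filter_upwards [self_mem_nhdsWithin] with q hq
    rw [← integral_const_mul]
    exact integral_mono hmin_int ((hint hq).const_mul _) fun x =>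
      min_le_two_rpow_mul_rpow_add_rpow_rpow (h₁pos x) (h₂pos x) hq
  · filter_upwards [self_mem_nhdsWithin] with q hq
    gcongr 2 ^ (q - 1) * ?_
    exact integral_mono (hint hq) hmin_int fun x =>
      rpow_add_rpow_rpow_le_min (h₁pos x) (h₂pos x) hq
end
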